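/- arXiv:math/0703581 — 4 statements merged into one kernel-verified Lean document; each statement's English description precedes it below -/
import Mathlib

section
/- The ℤ_p-module E is a direct summand of ℤ_p[X_{ij}]_{≤d}, and for every commutative ℤ_p-algebra R and every g ∈ GL_n(R), one has g ∈ G(R) if and only if η_g(E_R) = E_R; in other words, the flat closed subgroup scheme G of GL_n is exactly the stabilizer of the direct summand E. -/
universe u

open scoped TensorProduct

/-- Membership in `G(R)`: a matrix `m ∈ M_n(R)` lies in `G(R)` iff every `f ∈ I` vanishes
when evaluated (over `R`) at the entries of `m`. -/
def Gmem {p : ℕ} [Fact p.Prime] {n : ℕ} (I : Ideal (MvPolynomial (Fin n × Fin n) ℤ_[p]))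
    (R : Type u) [CommRing R] [Algebra ℤ_[p] R] (m : Matrix (Fin n) (Fin n) R) : Prop :=
  ∀ f ∈ I, MvPolynomial.aeval (fun ij : Fin n × Fin n => m ij.1 ij.2) f = 0

/-- The `R`-algebra automorphism `η_g` of `R[X_{ij}]` attached to `g ∈ GL_n(R)`, determined by
`η_g(X_{ij}) = Σ_k (g⁻¹)_{ik} X_{kj}`, so that `(η_g f)(y) = f(g⁻¹ y)`. -/
noncomputable def etaAut {R : Type u} [CommRing R] {n : ℕ}
    (g : Matrix.GeneralLinearGroup (Fin n) R) :
    MvPolynomial (Fin n × Fin n) R →ₐ[R] MvPolynomial (Fin n × Fin n) R :=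
  MvPolynomial.aeval fun ij : Fin n × Fin n =>
    ∑ k : Fin n,
      MvPolynomial.C ((↑(g⁻¹) : Matrix (Fin n) (Fin n) R) ij.1 k) *
        MvPolynomial.X (k, ij.2)

/-- The `ℤ_[p]`-submodule `E = I ∩ ℤ_[p][X_{ij}]_{≤d}`. -/
noncomputable def Esub {p : ℕ} [Fact p.Prime] {n : ℕ}
    (I : Ideal (MvPolynomial (Fin n × Fin n) ℤ_[p])) (d : ℕ) :
    Submodule ℤ_[p] (MvPolynomial (Fin n × Fin n) ℤ_[p]) :=
  I.restrictScalars ℤ_[p] ⊓ MvPolynomial.restrictTotalDegree (Fin n × Fin n) ℤ_[p] d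

/-- `E_R`: the `R`-submodule of `R[X_{ij}]` generated by the image of `E`. -/
noncomputable def ERsub {p : ℕ} [Fact p.Prime] {n : ℕ}
    (E : Submodule ℤ_[p] (MvPolynomial (Fin n × Fin n) ℤ_[p]))
    (R : Type u) [CommRing R] [Algebra ℤ_[p] R] :
    Submodule R (MvPolynomial (Fin n × Fin n) R) :=
  Submodule.span R (⇑(MvPolynomial.map (algebraMap ℤ_[p] R)) '' (E : Set _))

namespace MvPolynomial

theorem totalDegree_aeval_le {σ τ R S : Type*} [CommSemiring R] [CommSemiring S] [Algebra R S]
    (q : σ → MvPolynomial τ S) (hq : ∀ i, (q i).totalDegree ≤ 1) (f : MvPolynomial σ R) :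
    (aeval q f).totalDegree ≤ f.totalDegree := by
  rw [aeval_def, eval₂_eq]
  refine totalDegree_finsetSum_le fun m hm => ?_
  rw [IsScalarTower.algebraMap_apply R S (MvPolynomial τ S), ← smul_eq_mul,
    algebraMap_smul]
  refine (totalDegree_smul_le _ _).trans ((totalDegree_finsetProd _ _).trans
    (le_trans (Finset.sum_le_sum fun i _ => ?_) (le_totalDegree hm)))
  exact (totalDegree_pow _ _).trans (by simpa using Nat.mul_le_mul_left (m i) (hq i))

section Flat

variable {σ k : Type*} [CommRing k] (I : Ideal (MvPolynomial σ k)) (d : ℕ)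

/-- Restriction of polynomials of total degree at most `d` to the closed subscheme cut out
by `I`. -/
noncomputable def restrictTotalDegreeQuotient :
    restrictTotalDegree σ k d →ₗ[k] MvPolynomial σ k ⧸ I :=
  (Ideal.Quotient.mkₐ k I).toLinearMap ∘ₗ (restrictTotalDegree σ k d).subtype

theorem ker_restrictTotalDegreeQuotient :
    LinearMap.ker (restrictTotalDegreeQuotient I d) =
      (I.restrictScalars k ⊓ restrictTotalDegree σ k d).comap
        (restrictTotalDegree σ k d).subtype := by
  ext x
  simp [restrictTotalDegreeQuotient, Ideal.Quotient.eq_zero_iff_mem]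

/-- Over a principal ideal domain, the polynomials of bounded degree in an ideal with flat
quotient form a direct summand. -/
theorem exists_isCompl_of_flat_quotient [IsDomain k] [IsPrincipalIdealRing k] [Finite σ]
    [Module.Flat k (MvPolynomial σ k ⧸ I)] :
    ∃ C : Submodule k (restrictTotalDegree σ k d),
      IsCompl ((I.restrictScalars k ⊓ restrictTotalDegree σ k d).comap
        (restrictTotalDegree σ k d).subtype) C := by
  rw [← ker_restrictTotalDegreeQuotient]
  let φ := (restrictTotalDegreeQuotient I d).rangeRestrict
  obtain ⟨s, hs⟩ := Module.projective_lifting_property φ LinearMap.id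
    (LinearMap.surjective_rangeRestrict _)
  refine ⟨LinearMap.range s, ?_⟩
  have hs' : ∀ y, φ (s y) = y := LinearMap.congr_fun hs
  have hproj : ∀ x : LinearMap.range s, (s.rangeRestrict ∘ₗ φ) x = x := by
    rintro ⟨_, y, rfl⟩
    exact Subtype.ext (congrArg s (hs' y))
  have hker : LinearMap.ker s.rangeRestrict = ⊥ := by
    rw [LinearMap.ker_rangeRestrict, LinearMap.ker_eq_bot]
    exact Function.LeftInverse.injective hs'
  have hcompl := (LinearMap.isCompl_of_proj hproj).symm
  rwa [LinearMap.ker_comp, hker, Submodule.comap_bot, LinearMap.ker_rangeRestrict] at hcompl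

/-- Membership of a polynomial of bounded degree in the extension of an ideal along a flat
base change can be tested on the universal point. -/
theorem mem_span_of_aeval_quotient_eq_zero {B : Type*} [CommRing B] [Algebra k B]
    [Module.Flat k B] (F : MvPolynomial σ B) (hdeg : F.totalDegree ≤ d)
    (hF : aeval (fun i => (1 : B) ⊗ₜ[k] Ideal.Quotient.mk I (X i)) F = 0) :
    F ∈ Submodule.span B (⇑(map (algebraMap k B)) ''
      (I.restrictScalars k ⊓ restrictTotalDegree σ k d : Submodule k (MvPolynomial σ k))) := by
  set E : Submodule k (MvPolynomial σ k) := I.restrictScalars k ⊓ restrictTotalDegree σ k d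
  let Ψ := (algebraTensorAlgEquiv (σ := σ) k B).toAlgHom
  let ι := (restrictTotalDegree σ k d).subtype
  have hexact : Function.Exact (LinearMap.ker (restrictTotalDegreeQuotient I d)).subtype
      (restrictTotalDegreeQuotient I d) := by
    rw [LinearMap.exact_iff, Submodule.range_subtype]
  obtain ⟨t, ht⟩ : ∃ t, Ψ (LinearMap.lTensor B ι t) = F := by
    have hmon : ∀ m ∈ F.support, monomial m (1 : k) ∈ restrictTotalDegree σ k d := fun m hm => by
      rw [mem_restrictTotalDegree]
      exact (totalDegree_monomial_le _ _).trans ((le_totalDegree hm).trans hdeg)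
    refine ⟨∑ m ∈ F.support.attach, F.coeff m ⊗ₜ ⟨monomial m.1 1, hmon m.1 m.2⟩, ?_⟩
    conv_rhs => rw [F.as_sum, ← Finset.sum_attach]
    simp [Ψ, ι, smul_monomial]
  have hcomp : (aeval (fun i => (1 : B) ⊗ₜ[k] Ideal.Quotient.mk I (X i))).comp Ψ =
      Algebra.TensorProduct.map (AlgHom.id B B) (Ideal.Quotient.mkₐ k I) := by
    ext i
    simp [Ψ]
  have hzero : LinearMap.lTensor B (restrictTotalDegreeQuotient I d) t = 0 := by
    rw [← hF, ← ht, ← AlgHom.comp_apply, hcomp, restrictTotalDegreeQuotient,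
      LinearMap.lTensor_comp]
    rfl
  obtain ⟨s, rfl⟩ := (Module.Flat.lTensor_exact B
    (N := LinearMap.ker (restrictTotalDegreeQuotient I d)) hexact t).1 hzero
  rw [← ht]
  clear ht hzero
  induction s with
  | zero => simp
  | add x y hx hy => simpa using add_mem hx hy
  | tmul b e =>
    have he : (e : restrictTotalDegree σ k d) ∈ E.comap ι :=
      ker_restrictTotalDegreeQuotient I d ▸ e.2
    have hmem := Submodule.smul_mem _ b (Submodule.subset_span (R := B)
      (Set.mem_image_of_mem (map (algebraMap k B)) (Submodule.mem_comap.1 he)))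
    simpa [Ψ] using hmem

end Flat

section Translate

variable {n : Type*} [Fintype n] {R : Type*} [CommRing R]

/-- The substitution `X ↦ h X` on polynomials in the entries of a square matrix. -/
noncomputable def leftTranslate (h : Matrix n n R) :
    MvPolynomial (n × n) R →ₐ[R] MvPolynomial (n × n) R :=
  aeval fun ij => ∑ l, C (h ij.1 l) * X (l, ij.2)

variable {k : Type*} [CommRing k] [Algebra k R]

theorem totalDegree_leftTranslate_le (h : Matrix n n R) (f : MvPolynomial (n × n) R) :
    (leftTranslate h f).totalDegree ≤ f.totalDegree := by
  refine totalDegree_aeval_le _ (fun ij => totalDegree_finsetSum_le fun l _ => ?_) f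
  rw [← smul_eq_C_mul]
  exact (totalDegree_smul_le _ _).trans ((totalDegree_monomial_le _ _).trans (by simp))

theorem aeval_leftTranslate_map {S : Type*} [CommRing S] [Algebra k S] [Algebra R S]
    [IsScalarTower k R S] (h : Matrix n n R) (x : Matrix n n S) (f : MvPolynomial (n × n) k) :
    aeval (fun ij => x ij.1 ij.2) (leftTranslate h (map (algebraMap k R) f)) =
      aeval (fun ij => (h.map (algebraMap R S) * x) ij.1 ij.2) f := by
  induction f using MvPolynomial.induction_on with
  | C a => simp [← IsScalarTower.algebraMap_apply]
  | add p q hp hq => simp only [map_add, hp, hq]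
  | mul_X p i hp =>
    simp only [map_mul, hp]
    simp [leftTranslate, Matrix.mul_apply]

theorem map_leftTranslate {S : Type*} [CommRing S] (φ : R →+* S) (h : Matrix n n R)
    (f : MvPolynomial (n × n) R) :
    map φ (leftTranslate h f) = leftTranslate (h.map φ) (map φ f) := by
  induction f using MvPolynomial.induction_on with
  | C a => simp
  | add p q hp hq => simp only [map_add, hp, hq]
  | mul_X p i hp =>
    simp only [map_mul, hp]
    simp [leftTranslate]

theorem leftTranslate_mul (h h' : Matrix n n R) (f : MvPolynomial (n × n) R) :
    leftTranslate (h * h') f = leftTranslate h' (leftTranslate h f) := by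
  induction f using MvPolynomial.induction_on with
  | C a => simp
  | add p q hp hq => simp only [map_add, hp, hq]
  | mul_X p i hp =>
    simp only [map_mul, hp]
    simp [leftTranslate, Matrix.mul_apply, Finset.mul_sum, Finset.sum_mul, mul_assoc]
    rw [Finset.sum_comm]

theorem leftTranslate_one [DecidableEq n] (f : MvPolynomial (n × n) R) :
    leftTranslate (1 : Matrix n n R) f = f := by
  induction f using MvPolynomial.induction_on with
  | C a => simp
  | add p q hp hq => simp only [map_add, hp, hq]
  | mul_X p i hp =>
    simp only [map_mul, hp]
    simp [leftTranslate, Matrix.one_apply]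

end Translate

end MvPolynomial

open MvPolynomial

section Stabilizer

variable {p : ℕ} [Fact p.Prime] {n : ℕ} {I : Ideal (MvPolynomial (Fin n × Fin n) ℤ_[p])}

theorem etaAut_eq_leftTranslate {R : Type u} [CommRing R]
    (g : Matrix.GeneralLinearGroup (Fin n) R) :
    etaAut g = leftTranslate (↑(g⁻¹) : Matrix (Fin n) (Fin n) R) :=
  rfl

theorem Gmem_of_algHom {S : Type u} [CommRing S] [Algebra ℤ_[p] S]
    (φ : (MvPolynomial (Fin n × Fin n) ℤ_[p] ⧸ I) →ₐ[ℤ_[p]] S) :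
    Gmem I S (Matrix.of fun i j => φ (Ideal.Quotient.mk I (X (i, j)))) := by
  intro f hf
  have h : aeval (fun ij : Fin n × Fin n => φ (Ideal.Quotient.mk I (X (ij.1, ij.2)))) =
      φ.comp (Ideal.Quotient.mkₐ ℤ_[p] I) := by
    ext i
    simp
  simp only [Matrix.of_apply, h]
  simp [Ideal.Quotient.eq_zero_iff_mem.2 hf]

/-- The stabilizer inclusion for the universal point of `G`, whose coordinate ring is flat. -/
theorem leftTranslate_universal_mem
    [Module.Flat ℤ_[p] (MvPolynomial (Fin n × Fin n) ℤ_[p] ⧸ I)]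
    (hmul : ∀ (R : Type u) [CommRing R] [Algebra ℤ_[p] R]
      (m m' : Matrix (Fin n) (Fin n) R), Gmem I R m → Gmem I R m' → Gmem I R (m * m'))
    {d : ℕ} {f : MvPolynomial (Fin n × Fin n) ℤ_[p]} (hf : f ∈ Esub I d) :
    leftTranslate (Matrix.of fun i j => ULift.up.{u} (Ideal.Quotient.mk I (X (i, j))))
      (map (algebraMap ℤ_[p] (ULift.{u} (MvPolynomial (Fin n × Fin n) ℤ_[p] ⧸ I))) f) ∈
        ERsub (Esub I d) (ULift.{u} (MvPolynomial (Fin n × Fin n) ℤ_[p] ⧸ I)) := by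
  set A := MvPolynomial (Fin n × Fin n) ℤ_[p] ⧸ I
  have hdeg : f.totalDegree ≤ d := (mem_restrictTotalDegree _ _ _).1 hf.2
  have hmapdeg : (map (algebraMap ℤ_[p] (ULift.{u} A)) f).totalDegree ≤ f.totalDegree :=
    Finset.sup_mono (support_map_subset _ _)
  refine mem_span_of_aeval_quotient_eq_zero I d _
    ((totalDegree_leftTranslate_le _ _).trans (hmapdeg.trans hdeg)) ?_
  have hleft := Gmem_of_algHom (I := I) (S := ULift.{u} A ⊗[ℤ_[p]] A)
    ((Algebra.TensorProduct.includeLeft (R := ℤ_[p]) (S := ℤ_[p]) (A := ULift.{u} A)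
      (B := A)).comp (ULift.algEquiv (R := ℤ_[p]) (A := A)).symm.toAlgHom)
  have hright := Gmem_of_algHom (I := I) (S := ULift.{u} A ⊗[ℤ_[p]] A)
    (Algebra.TensorProduct.includeRight (R := ℤ_[p]) (A := ULift.{u} A) (B := A))
  exact (aeval_leftTranslate_map _ (Matrix.of fun i j =>
    (1 : ULift.{u} A) ⊗ₜ[ℤ_[p]] Ideal.Quotient.mk I (X (i, j))) f).trans
      (hmul _ _ _ hleft hright f hf.1)

theorem leftTranslate_mem_ERsub
    [Module.Flat ℤ_[p] (MvPolynomial (Fin n × Fin n) ℤ_[p] ⧸ I)]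
    (hmul : ∀ (R : Type u) [CommRing R] [Algebra ℤ_[p] R]
      (m m' : Matrix (Fin n) (Fin n) R), Gmem I R m → Gmem I R m' → Gmem I R (m * m'))
    {d : ℕ} {R : Type u} [CommRing R] [Algebra ℤ_[p] R] {h : Matrix (Fin n) (Fin n) R}
    (hh : Gmem I R h) {F : MvPolynomial (Fin n × Fin n) R} (hF : F ∈ ERsub (Esub I d) R) :
    leftTranslate h F ∈ ERsub (Esub I d) R := by
  induction hF using Submodule.span_induction with
  | zero => simp
  | add x y _ _ hx hy => simpa using add_mem hx hy
  | smul a x _ hx => simpa using Submodule.smul_mem _ a hx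
  | mem x hx =>
    obtain ⟨f, hf, rfl⟩ := hx
    let ψ : ULift.{u} (MvPolynomial (Fin n × Fin n) ℤ_[p] ⧸ I) →ₐ[ℤ_[p]] R :=
      (Ideal.Quotient.liftₐ I (aeval fun ij : Fin n × Fin n => h ij.1 ij.2) hh).comp
        (ULift.algEquiv (R := ℤ_[p])).toAlgHom
    have hmap : ∀ q : MvPolynomial (Fin n × Fin n) ℤ_[p],
        map ψ.toRingHom (map (algebraMap ℤ_[p] _) q) = map (algebraMap ℤ_[p] R) q := fun q => by
      rw [map_map, AlgHom.toRingHom_eq_coe, AlgHom.comp_algebraMap]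
    have hpoint : (Matrix.of fun i j => ULift.up.{u} (Ideal.Quotient.mk I (X (i, j)))).map
        ψ.toRingHom = h := by
      ext i j
      exact aeval_X _ _
    have key := leftTranslate_universal_mem hmul hf
    rw [← hmap f, ← hpoint, ← map_leftTranslate]
    refine Submodule.span_induction (fun x hx => ?_) (by simp)
      (fun x y _ _ hx hy => by simpa using add_mem hx hy) (fun a x _ hx => ?_) key
    · obtain ⟨q, hq, rfl⟩ := hx
      rw [hmap]
      exact Submodule.subset_span (Set.mem_image_of_mem _ hq)
    · rw [smul_eq_C_mul, map_mul, map_C, ← smul_eq_C_mul]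
      exact Submodule.smul_mem _ _ hx

theorem aeval_one_eq_zero_of_mem_ERsub {R : Type u} [CommRing R] [Algebra ℤ_[p] R]
    (hone : Gmem I R (1 : Matrix (Fin n) (Fin n) R)) {d : ℕ}
    {F : MvPolynomial (Fin n × Fin n) R} (hF : F ∈ ERsub (Esub I d) R) :
    aeval (fun ij : Fin n × Fin n => (1 : Matrix (Fin n) (Fin n) R) ij.1 ij.2) F = 0 := by
  induction hF using Submodule.span_induction with
  | zero => simp
  | add x y _ _ hx hy => rw [map_add, hx, hy, add_zero]
  | smul a x _ hx => rw [map_smul, hx, smul_zero]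
  | mem x hx =>
    obtain ⟨f, hf, rfl⟩ := hx
    rw [aeval_map_algebraMap]
    exact hone f hf.1

end Stabilizer

/-- `p` an odd prime, `n ≥ 1`, `I ⊆ ℤ_[p][X_{ij}]` an ideal with flat quotient
defining a subgroup scheme `G` of `GL_n` (each element of `G(R)` is invertible and `G(R)` is a
subgroup of `GL_n(R)`); `f_1, …, f_r` generators of `I`, `d` the maximum of their total degrees,
and `E = I ∩ ℤ_[p][X_{ij}]_{≤d}`.  Then `E` is a direct summand of the `ℤ_[p]`-module
`ℤ_[p][X_{ij}]_{≤d}`, and for every commutative `ℤ_[p]`-algebra `R` and every `g ∈ GL_n(R)`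
one has `g ∈ G(R) ↔ η_g(E_R) = E_R`: `G` is exactly the stabilizer of `E`. -/
theorem flat_group_is_stabilizer_of_direct_summand {p : ℕ} [Fact p.Prime] (hp : Odd p)
    {n : ℕ} (hn : 1 ≤ n) (I : Ideal (MvPolynomial (Fin n × Fin n) ℤ_[p]))
    (hflat : Module.Flat ℤ_[p] (MvPolynomial (Fin n × Fin n) ℤ_[p] ⧸ I))
    (hunit : ∀ (R : Type u) [CommRing R] [Algebra ℤ_[p] R]
      (m : Matrix (Fin n) (Fin n) R), Gmem I R m → IsUnit m)
    (hone : ∀ (R : Type u) [CommRing R] [Algebra ℤ_[p] R],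
      Gmem I R (1 : Matrix (Fin n) (Fin n) R))
    (hmul : ∀ (R : Type u) [CommRing R] [Algebra ℤ_[p] R]
      (m m' : Matrix (Fin n) (Fin n) R), Gmem I R m → Gmem I R m' → Gmem I R (m * m'))
    (hinv : ∀ (R : Type u) [CommRing R] [Algebra ℤ_[p] R]
      (m : Matrix (Fin n) (Fin n) R), Gmem I R m → Gmem I R m⁻¹)
    (r : ℕ) (f : Fin r → MvPolynomial (Fin n × Fin n) ℤ_[p])
    (hgen : I = Ideal.span (Set.range f))
    (d : ℕ) (hd : d = Finset.univ.sup fun i => (f i).totalDegree) :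
    (∃ C : Submodule ℤ_[p] (MvPolynomial.restrictTotalDegree (Fin n × Fin n) ℤ_[p] d),
        IsCompl
          ((Esub I d).comap (MvPolynomial.restrictTotalDegree (Fin n × Fin n) ℤ_[p] d).subtype)
          C)
      ∧ ∀ (R : Type u) [CommRing R] [Algebra ℤ_[p] R]
          (g : Matrix.GeneralLinearGroup (Fin n) R),
          Gmem I R (↑g : Matrix (Fin n) (Fin n) R) ↔
            Submodule.map (etaAut g).toLinearMap (ERsub (Esub I d) R) = ERsub (Esub I d) R := by
  refine ⟨exists_isCompl_of_flat_quotient I d, fun R _ _ g => ⟨fun hg => ?_, fun hstab => ?_⟩⟩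
  · have hginv : Gmem I R (↑(g⁻¹) : Matrix (Fin n) (Fin n) R) := by
      rw [Matrix.coe_units_inv]
      exact hinv R _ hg
    rw [etaAut_eq_leftTranslate]
    refine le_antisymm (Submodule.map_le_iff_le_comap.2 fun F hF =>
      leftTranslate_mem_ERsub hmul hginv hF) fun F hF =>
        ⟨_, leftTranslate_mem_ERsub hmul hg hF, ?_⟩
    rw [AlgHom.toLinearMap_apply, ← leftTranslate_mul, Units.mul_inv, leftTranslate_one]
  · have hgens : ∀ i, aeval (fun ij : Fin n × Fin n =>
        (↑(g⁻¹) : Matrix (Fin n) (Fin n) R) ij.1 ij.2) (f i) = 0 := fun i => by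
      have hfi : f i ∈ Esub I d := ⟨hgen ▸ Ideal.subset_span ⟨i, rfl⟩,
        (mem_restrictTotalDegree _ _ _).2
          (hd ▸ Finset.le_sup (f := fun i => (f i).totalDegree) (Finset.mem_univ i))⟩
      have hmem := hstab.le (Submodule.mem_map_of_mem
        (Submodule.subset_span (Set.mem_image_of_mem (map (algebraMap ℤ_[p] R)) hfi)))
      rw [etaAut_eq_leftTranslate, AlgHom.toLinearMap_apply] at hmem
      simpa using (aeval_leftTranslate_map _ _ _).symm.trans
        (aeval_one_eq_zero_of_mem_ERsub (hone R) hmem)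
    have hginv : Gmem I R (↑(g⁻¹) : Matrix (Fin n) (Fin n) R) := by
      have hle : I ≤ RingHom.ker (aeval (R := ℤ_[p]) fun ij : Fin n × Fin n =>
          (↑(g⁻¹) : Matrix (Fin n) (Fin n) R) ij.1 ij.2) := by
        rw [hgen, Ideal.span_le]
        rintro _ ⟨i, rfl⟩
        exact hgens i
      exact fun q hq => hle hq
    simpa [Matrix.coe_units_inv] using hinv R _ hginv
end

section
/- For every commutative ℤ_p-algebra R and every g ∈ GL_n(R), one has g ∈ G(R) if and only if η_g maps the R-submodule (I·R[X_{ij}]) ∩ R[X_{ij}]_{≤d} onto itself. -/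
universe u

/-- The `R`-submodule `(I·R[X_{ij}]) ∩ R[X_{ij}]_{≤d}` of `R[X_{ij}]`. -/
noncomputable def IRinterDeg {p : ℕ} [Fact p.Prime] {n : ℕ}
    (I : Ideal (MvPolynomial (Fin n × Fin n) ℤ_[p])) (d : ℕ)
    (R : Type u) [CommRing R] [Algebra ℤ_[p] R] :
    Submodule R (MvPolynomial (Fin n × Fin n) R) :=
  (Ideal.map (MvPolynomial.map (algebraMap ℤ_[p] R) :
      MvPolynomial (Fin n × Fin n) ℤ_[p] →+* MvPolynomial (Fin n × Fin n) R) I).restrictScalars R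
    ⊓ MvPolynomial.restrictTotalDegree (Fin n × Fin n) R d

namespace MvPolynomial

variable {R S : Type*} [CommRing R] [CommRing S] [Algebra R S] {n : ℕ}

/-- Evaluating `η_g h` at `y` amounts to evaluating `h` at `g⁻¹ y`. -/
theorem aeval_etaAut (g : Matrix.GeneralLinearGroup (Fin n) R) (y : Matrix (Fin n) (Fin n) S)
    (h : MvPolynomial (Fin n × Fin n) R) :
    aeval (fun ij : Fin n × Fin n => y ij.1 ij.2) (etaAut g h) =
      aeval (fun ij : Fin n × Fin n =>
        ((↑(g⁻¹) : Matrix (Fin n) (Fin n) R).map (algebraMap R S) * y) ij.1 ij.2) h := by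
  have key : (aeval (fun ij : Fin n × Fin n => y ij.1 ij.2)).comp (etaAut g) =
      aeval (fun ij : Fin n × Fin n =>
        ((↑(g⁻¹) : Matrix (Fin n) (Fin n) R).map (algebraMap R S) * y) ij.1 ij.2) := by
    ext ij
    simp [etaAut, Matrix.mul_apply, -Matrix.coe_units_inv]
  exact DFunLike.congr_fun key h

theorem etaAut_etaAut_inv (g : Matrix.GeneralLinearGroup (Fin n) R)
    (h : MvPolynomial (Fin n × Fin n) R) : etaAut g (etaAut g⁻¹ h) = h := by
  have key := aeval_etaAut (S := MvPolynomial (Fin n × Fin n) R) g⁻¹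
    ((↑(g⁻¹) : Matrix (Fin n) (Fin n) R).map (algebraMap R (MvPolynomial (Fin n × Fin n) R)) *
      Matrix.of fun i j => X (i, j)) h
  rw [← Matrix.mul_assoc, ← Matrix.map_mul, inv_inv, ← Units.val_mul, mul_inv_cancel,
    Units.val_one, Matrix.map_one _ (map_zero _) (map_one _), Matrix.one_mul] at key
  simpa [etaAut, Matrix.mul_apply, algebraMap_eq, -Matrix.coe_units_inv] using key

theorem totalDegree_etaAut_le (g : Matrix.GeneralLinearGroup (Fin n) R)
    (h : MvPolynomial (Fin n × Fin n) R) : (etaAut g h).totalDegree ≤ h.totalDegree := by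
  rw [etaAut, aeval_def, eval₂_eq]
  refine totalDegree_finsetSum_le fun s hs => ?_
  refine (totalDegree_mul _ _).trans ?_
  rw [algebraMap_eq, totalDegree_C, zero_add]
  refine (totalDegree_finsetProd _ _).trans
    (le_trans (Finset.sum_le_sum fun ij _ => ?_) (le_totalDegree hs))
  refine (totalDegree_pow _ _).trans (mul_le_of_le_one_right (Nat.zero_le _) ?_)
  refine totalDegree_finsetSum_le fun k _ => (totalDegree_mul _ _).trans ?_
  rw [totalDegree_C, zero_add]
  exact (totalDegree_monomial_le _ _).trans (by simp)

end MvPolynomial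

section Group

variable {p : ℕ} [Fact p.Prime] {n : ℕ} {I : Ideal (MvPolynomial (Fin n × Fin n) ℤ_[p])}
  {R : Type u} [CommRing R] [Algebra ℤ_[p] R]

theorem Gmem.aeval_eq_zero {m : Matrix (Fin n) (Fin n) R} (hm : Gmem I R m)
    {h : MvPolynomial (Fin n × Fin n) R}
    (hh : h ∈ Ideal.map (MvPolynomial.map (algebraMap ℤ_[p] R)) I) :
    MvPolynomial.aeval (fun ij : Fin n × Fin n => m ij.1 ij.2) h = 0 := by
  suffices H : Ideal.map (MvPolynomial.map (algebraMap ℤ_[p] R)) I ≤ RingHom.ker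
      (MvPolynomial.aeval (R := R) fun ij : Fin n × Fin n => m ij.1 ij.2) from H hh
  refine Ideal.map_le_iff_le_comap.mpr fun f hf => ?_
  rw [Ideal.mem_comap, RingHom.mem_ker, MvPolynomial.aeval_map_algebraMap]
  exact hm f hf

theorem Gmem.map {S : Type*} [CommRing S] [Algebra ℤ_[p] S] {m : Matrix (Fin n) (Fin n) R}
    (hm : Gmem I R m) (φ : R →ₐ[ℤ_[p]] S) : Gmem I S (m.map φ) := by
  intro f hf
  have h := congrArg φ (hm f hf)
  rwa [map_zero, ← AlgHom.comp_apply, MvPolynomial.comp_aeval] at h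

/-- If `G` is closed under multiplication and `g⁻¹ ∈ G(R)`, then `η_g` preserves `I·R[X_{ij}]`,
as one sees by multiplying the universal point of `G` by `g⁻¹`. -/
theorem etaAut_mem_map
    (hmul : ∀ (R : Type u) [CommRing R] [Algebra ℤ_[p] R]
      (m m' : Matrix (Fin n) (Fin n) R), Gmem I R m → Gmem I R m' → Gmem I R (m * m'))
    {g : Matrix.GeneralLinearGroup (Fin n) R}
    (hg : Gmem I R (↑(g⁻¹) : Matrix (Fin n) (Fin n) R)) {h : MvPolynomial (Fin n × Fin n) R}
    (hh : h ∈ Ideal.map (MvPolynomial.map (algebraMap ℤ_[p] R)) I) :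
    etaAut g h ∈ Ideal.map (MvPolynomial.map (algebraMap ℤ_[p] R)) I := by
  set J := Ideal.map (MvPolynomial.map (algebraMap ℤ_[p] R)) I
  suffices H : J ≤ J.comap (etaAut g) from H hh
  refine Ideal.map_le_iff_le_comap.mpr fun f hf => ?_
  let x : Matrix (Fin n) (Fin n) (MvPolynomial (Fin n × Fin n) R ⧸ J) :=
    Matrix.of fun i j => Ideal.Quotient.mk J (MvPolynomial.X (i, j))
  have aeval_x (q : MvPolynomial (Fin n × Fin n) R) :
      MvPolynomial.aeval (fun ij : Fin n × Fin n => x ij.1 ij.2) q = Ideal.Quotient.mk J q := by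
    have key : MvPolynomial.aeval (fun ij : Fin n × Fin n => x ij.1 ij.2) =
        Ideal.Quotient.mkₐ R J := by
      ext ij
      simp [x]
    exact DFunLike.congr_fun key q
  have hx : Gmem I _ x := by
    intro q hq
    rw [← MvPolynomial.aeval_map_algebraMap R, aeval_x, Ideal.Quotient.eq_zero_iff_mem]
    exact Ideal.mem_map_of_mem _ hq
  have hgx := hmul _ _ _ (hg.map (IsScalarTower.toAlgHom ℤ_[p] R _)) hx f hf
  rw [Ideal.mem_comap, Ideal.mem_comap, ← Ideal.Quotient.eq_zero_iff_mem, ← aeval_x]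
  refine (MvPolynomial.aeval_etaAut g x _).trans ?_
  rw [MvPolynomial.aeval_map_algebraMap]
  exact hgx

theorem map_etaAut_le
    (hmul : ∀ (R : Type u) [CommRing R] [Algebra ℤ_[p] R]
      (m m' : Matrix (Fin n) (Fin n) R), Gmem I R m → Gmem I R m' → Gmem I R (m * m'))
    (d : ℕ) {g : Matrix.GeneralLinearGroup (Fin n) R}
    (hg : Gmem I R (↑(g⁻¹) : Matrix (Fin n) (Fin n) R)) :
    Submodule.map (etaAut g).toLinearMap (IRinterDeg I d R) ≤ IRinterDeg I d R := by
  rintro _ ⟨h, ⟨hI, hdeg⟩, rfl⟩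
  refine ⟨etaAut_mem_map hmul hg hI, ?_⟩
  rw [SetLike.mem_coe, MvPolynomial.mem_restrictTotalDegree] at hdeg ⊢
  exact (MvPolynomial.totalDegree_etaAut_le g h).trans hdeg

end Group

/-- With `p` an odd prime, `n ≥ 1`, `I ⊆ ℤ_[p][X_{ij}]` an ideal with flat
quotient defining a subgroup scheme `G` of `GL_n`, generators `f_1, …, f_r` of `I` and `d` the
maximum of their total degrees: for every commutative `ℤ_[p]`-algebra `R` and every
`g ∈ GL_n(R)`, one has `g ∈ G(R)` iff `η_g` maps the `R`-submodule
`(I·R[X_{ij}]) ∩ R[X_{ij}]_{≤d}` onto itself. -/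
theorem mem_group_iff_eta_stabilizes_ideal_inter {p : ℕ} [Fact p.Prime] (hp : Odd p)
    {n : ℕ} (hn : 1 ≤ n) (I : Ideal (MvPolynomial (Fin n × Fin n) ℤ_[p]))
    (hflat : Module.Flat ℤ_[p] (MvPolynomial (Fin n × Fin n) ℤ_[p] ⧸ I))
    (hunit : ∀ (R : Type u) [CommRing R] [Algebra ℤ_[p] R]
      (m : Matrix (Fin n) (Fin n) R), Gmem I R m → IsUnit m)
    (hone : ∀ (R : Type u) [CommRing R] [Algebra ℤ_[p] R],
      Gmem I R (1 : Matrix (Fin n) (Fin n) R))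
    (hmul : ∀ (R : Type u) [CommRing R] [Algebra ℤ_[p] R]
      (m m' : Matrix (Fin n) (Fin n) R), Gmem I R m → Gmem I R m' → Gmem I R (m * m'))
    (hinv : ∀ (R : Type u) [CommRing R] [Algebra ℤ_[p] R]
      (m : Matrix (Fin n) (Fin n) R), Gmem I R m → Gmem I R m⁻¹)
    (r : ℕ) (f : Fin r → MvPolynomial (Fin n × Fin n) ℤ_[p])
    (hgen : I = Ideal.span (Set.range f))
    (d : ℕ) (hd : d = Finset.univ.sup fun i => (f i).totalDegree) :
    ∀ (R : Type u) [CommRing R] [Algebra ℤ_[p] R]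
      (g : Matrix.GeneralLinearGroup (Fin n) R),
      Gmem I R (↑g : Matrix (Fin n) (Fin n) R) ↔
        Submodule.map (etaAut g).toLinearMap (IRinterDeg I d R) = IRinterDeg I d R := by
  intro R _ _ g
  constructor
  · intro hg
    have hg' : Gmem I R (↑(g⁻¹) : Matrix (Fin n) (Fin n) R) := by
      rw [Matrix.coe_units_inv]
      exact hinv R _ hg
    refine le_antisymm (map_etaAut_le hmul d hg') fun h hh => ?_
    refine ⟨etaAut g⁻¹ h, ?_, MvPolynomial.etaAut_etaAut_inv g h⟩
    exact map_etaAut_le hmul d (by rwa [inv_inv]) (Submodule.mem_map_of_mem hh)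
  · intro H
    suffices hI : I ≤ RingHom.ker
        (MvPolynomial.aeval (R := ℤ_[p]) fun ij : Fin n × Fin n =>
          (↑g : Matrix (Fin n) (Fin n) R) ij.1 ij.2) from fun q hq => hI hq
    conv_lhs => rw [hgen]
    rw [Ideal.span_le]
    rintro _ ⟨i, rfl⟩
    have hf : MvPolynomial.map (algebraMap ℤ_[p] R) (f i) ∈ IRinterDeg I d R := by
      refine ⟨Ideal.mem_map_of_mem _ (hgen ▸ Ideal.subset_span ⟨i, rfl⟩), ?_⟩
      rw [SetLike.mem_coe, MvPolynomial.mem_restrictTotalDegree, hd]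
      exact (Finset.sup_mono (MvPolynomial.support_map_subset _ _)).trans
        (Finset.le_sup (f := fun i => (f i).totalDegree) (Finset.mem_univ i))
    rw [← H] at hf
    obtain ⟨h, ⟨hI, -⟩, hfh⟩ := hf
    have key := MvPolynomial.aeval_etaAut g (↑g : Matrix (Fin n) (Fin n) R) h
    rw [Algebra.algebraMap_self, RingHom.coe_id, Matrix.map_id, ← Units.val_mul, inv_mul_cancel,
      Units.val_one, (hone R).aeval_eq_zero hI] at key
    rw [SetLike.mem_coe, RingHom.mem_ker, ← MvPolynomial.aeval_map_algebraMap R, ← hfh]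
    exact key
end

section
/- Let N be an S-module admitting a finite filtration 0 = N₀ ⊆ N₁ ⊆ ⋯ ⊆ N_m = N by S-submodules such that each quotient N_{j+1}/N_j is either free as an S-module or free as an S/pS-module. Then the natural map N → (N ⊗_S A)^H, x ↦ x ⊗ 1 (where H acts on N ⊗_S A through its action on the factor A), is bijective. -/
open scoped TensorProduct

section InvariantsOfTensor

variable {S A : Type*} [CommRing S] [CommRing A] [Algebra S A] {H : Type*}

/-- For a family `f` of `S`-linear endomorphisms of `A`, the map `x ↦ x ⊗ 1` identifies `M` with
the elements of `M ⊗[S] A` fixed by every `M ⊗ f h`. -/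
def TensorInvariantsEq (f : H → A →ₗ[S] A) (M : Type*) [AddCommGroup M] [Module S M] : Prop :=
  (∀ x : M, x ⊗ₜ[S] (1 : A) = 0 → x = 0) ∧
    ∀ y : M ⊗[S] A, (∀ h, (f h).lTensor M y = y) → ∃ x : M, x ⊗ₜ[S] (1 : A) = y

namespace TensorInvariantsEq

variable {f : H → A →ₗ[S] A} {M M' M'' : Type*} [AddCommGroup M] [Module S M]
  [AddCommGroup M'] [Module S M'] [AddCommGroup M''] [Module S M'']

theorem lTensor_rTensor_comm (g : M →ₗ[S] M') (e : A →ₗ[S] A) (y : M ⊗[S] A) :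
    e.lTensor M' (g.rTensor A y) = g.rTensor A (e.lTensor M y) := by
  rw [← LinearMap.comp_apply, ← LinearMap.comp_apply, LinearMap.lTensor_comp_rTensor,
    LinearMap.rTensor_comp_lTensor]

theorem of_exact [Module.Flat S A] (hf : ∀ h, f h 1 = 1) {i : M' →ₗ[S] M} {g : M →ₗ[S] M''}
    (hi : Function.Injective i) (hg : Function.Surjective g) (hig : Function.Exact i g)
    (h' : TensorInvariantsEq f M') (h'' : TensorInvariantsEq f M'') :
    TensorInvariantsEq f M := by
  have hiA : Function.Injective (i.rTensor A) :=
    Module.Flat.rTensor_preserves_injective_linearMap i hi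
  refine ⟨fun x hx => ?_, fun y hy => ?_⟩
  · have hgx : g x = 0 := h''.1 _ (by simpa using congrArg (g.rTensor A) hx)
    obtain ⟨x', rfl⟩ := (hig x).1 hgx
    rw [h'.1 x' (hiA (by simpa using hx)), map_zero]
  · obtain ⟨x'', hx''⟩ := h''.2 (g.rTensor A y) fun h => by rw [lTensor_rTensor_comm, hy]
    obtain ⟨x, rfl⟩ := hg x''
    obtain ⟨z, hz⟩ := (rTensor_exact A hig hg (y - x ⊗ₜ 1)).1 (by simp [hx''])
    obtain ⟨x', rfl⟩ := h'.2 z fun h => hiA (by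
      rw [← lTensor_rTensor_comm, hz, map_sub, hy, LinearMap.lTensor_tmul, hf])
    refine ⟨x + i x', ?_⟩
    rw [LinearMap.rTensor_tmul] at hz
    rw [TensorProduct.add_tmul, hz, add_sub_cancel]

theorem of_linearEquiv (e : M ≃ₗ[S] M') (h : TensorInvariantsEq f M) :
    TensorInvariantsEq f M' := by
  refine ⟨fun x hx => ?_, fun y hy => ?_⟩
  · have := h.1 (e.symm x) (by
      simpa using congrArg (e.symm.toLinearMap.rTensor A) hx)
    simpa using this
  · obtain ⟨x, hx⟩ := h.2 (e.symm.toLinearMap.rTensor A y) fun k => by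
      rw [lTensor_rTensor_comm, hy]
    refine ⟨e x, ?_⟩
    have := congrArg (e.toLinearMap.rTensor A) hx
    rwa [LinearMap.rTensor_tmul, ← LinearMap.comp_apply, ← LinearMap.rTensor_comp,
      LinearEquiv.comp_symm, LinearMap.rTensor_id, LinearMap.id_apply] at this

theorem of_subsingleton [Subsingleton M] : TensorInvariantsEq f M :=
  ⟨fun _ _ => Subsingleton.elim _ _, fun _ _ => ⟨0, Subsingleton.elim _ _⟩⟩

theorem finsupp (κ : Type*) (hM : TensorInvariantsEq f M) : TensorInvariantsEq f (κ →₀ M) := by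
  classical
  refine ⟨fun x hx => ?_, fun y hy => ?_⟩
  · ext k
    exact hM.1 _ (by simpa using congrArg ((Finsupp.lapply (R := S) k).rTensor A) hx)
  · choose x hx using fun k => hM.2 ((Finsupp.lapply (R := S) k).rTensor A y) fun h => by
      rw [lTensor_rTensor_comm, hy]
    refine ⟨Finsupp.onFinset (TensorProduct.finsuppLeft S S M A κ y).support x
      fun k hk => ?_, ?_⟩
    · rw [Finsupp.mem_support_iff, TensorProduct.finsuppLeft_apply, ← hx]
      exact fun h0 => hk (hM.1 _ h0)
    · apply (TensorProduct.finsuppLeft S S M A κ).injective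
      ext k
      rw [TensorProduct.finsuppLeft_apply, TensorProduct.finsuppLeft_apply, ← hx]
      simp

theorem quotient_span_singleton (s : S)
    (hinj : ∀ t : S, algebraMap S A t ∈ Ideal.span {algebraMap S A s} → t ∈ Ideal.span {s})
    (hinv : ∀ a : A, (∀ h, f h a - a ∈ Ideal.span {algebraMap S A s}) →
      ∃ t : S, a - algebraMap S A t ∈ Ideal.span {algebraMap S A s}) :
    TensorInvariantsEq f (S ⧸ Ideal.span {s}) := by
  have key (a : A) : (1 : S ⧸ Ideal.span {s}) ⊗ₜ[S] a = 0 ↔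
      a ∈ Ideal.span {algebraMap S A s} := by
    rw [← (TensorProduct.quotTensorEquivQuotSMul A (Ideal.span {s})).map_eq_zero_iff,
      ← map_one (Ideal.Quotient.mk (Ideal.span {s})),
      TensorProduct.quotTensorEquivQuotSMul_mk_tmul, one_smul, Submodule.Quotient.mk_eq_zero,
      Submodule.ideal_span_singleton_smul, Submodule.mem_smul_pointwise_iff_exists,
      Ideal.mem_span_singleton]
    simp only [Submodule.mem_top, true_and, Algebra.smul_def, dvd_def, eq_comm]
  have mk_tmul (t : S) (a : A) : (Ideal.Quotient.mk (Ideal.span {s}) t) ⊗ₜ[S] a =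
      1 ⊗ₜ[S] (algebraMap S A t * a) := by
    rw [← Algebra.smul_def, ← TensorProduct.smul_tmul, Algebra.smul_def, mul_one]
    rfl
  refine ⟨fun x hx => ?_, fun y hy => ?_⟩
  · obtain ⟨t, rfl⟩ := Ideal.Quotient.mk_surjective x
    rw [mk_tmul, key, mul_one] at hx
    exact Ideal.Quotient.eq_zero_iff_mem.2 (hinj t hx)
  · obtain ⟨a, rfl⟩ : ∃ a : A, (1 : S ⧸ Ideal.span {s}) ⊗ₜ[S] a = y := by
      clear hy
      induction y with
      | zero => exact ⟨0, TensorProduct.tmul_zero _ _⟩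
      | tmul x a =>
        obtain ⟨t, rfl⟩ := Ideal.Quotient.mk_surjective x
        exact ⟨_, (mk_tmul t a).symm⟩
      | add _ _ hy hz =>
        obtain ⟨a, rfl⟩ := hy
        obtain ⟨b, rfl⟩ := hz
        exact ⟨a + b, TensorProduct.tmul_add _ _ _⟩
    obtain ⟨t, ht⟩ := hinv a fun h => by
      rw [← key, TensorProduct.tmul_sub, sub_eq_zero, ← LinearMap.lTensor_tmul, hy]
    refine ⟨Ideal.Quotient.mk _ t, ?_⟩
    rw [mk_tmul, mul_one, eq_comm, ← sub_eq_zero, ← TensorProduct.tmul_sub, key]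
    exact ht

theorem self (hinj : Function.Injective (algebraMap S A))
    (hinv : ∀ a : A, (∀ h, f h a = a) → ∃ t : S, algebraMap S A t = a) :
    TensorInvariantsEq f S := by
  refine ⟨fun x hx => hinj ?_, fun y hy => ?_⟩
  · simpa [Algebra.smul_def] using congrArg (TensorProduct.lid S A) hx
  · obtain ⟨a, rfl⟩ := (TensorProduct.lid S A).symm.surjective y
    obtain ⟨t, rfl⟩ := hinv a fun h => (TensorProduct.lid S A).symm.injective (by
      simpa using hy h)
    refine ⟨t, (TensorProduct.lid S A).injective ?_⟩
    simp [Algebra.smul_def]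

theorem of_filtration [Module.Flat S A] (hf : ∀ h, f h 1 = 1) (m : ℕ)
    (F : Fin (m + 1) → Submodule S M) (hmono : Monotone F) (hbot : F 0 = ⊥)
    (hquot : ∀ j : Fin m, TensorInvariantsEq f
      (F j.succ ⧸ ((F j.castSucc).comap (F j.succ).subtype))) (j : Fin (m + 1)) :
    TensorInvariantsEq f (F j) := by
  induction j using Fin.induction with
  | zero => rw [hbot]; exact of_subsingleton
  | succ j ih =>
    have hle : F j.castSucc ≤ F j.succ := hmono j.castSucc_le_succ
    refine of_exact hf (Submodule.inclusion_injective hle) (Submodule.mkQ_surjective _) ?_ ih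
      (hquot j)
    rw [LinearMap.exact_iff, Submodule.ker_mkQ, Submodule.range_inclusion]

end TensorInvariantsEq

end InvariantsOfTensor


open scoped TensorProduct

/-- Let `p` be a prime, `S` a commutative ring, `A` a flat commutative
`S`-algebra, and `H` a group acting on `A` by `S`-algebra automorphisms.  Assume `S → A` is
injective with image exactly `A^H`, and that the induced map `S/pS → A/pA` is injective with
image exactly `(A/pA)^H` (both phrased here at the level of `S` and `A`).  Let `N` be an
`S`-module with a finite filtration `0 = N₀ ⊆ ⋯ ⊆ N_m = N` whose successive quotients are free
over `S` or free over `S/pS`.  Then the natural map `N → (N ⊗_S A)^H`, `x ↦ x ⊗ 1`, is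
bijective: it is injective and its range is exactly the set of `H`-invariants of `N ⊗_S A`
(where `H` acts through the factor `A`). -/
theorem tensor_invariants_eq_of_filtration (p : ℕ) (hp : p.Prime)
    {S A : Type*} [CommRing S] [CommRing A] [Algebra S A] [Module.Flat S A]
    {H : Type*} [Group H] [MulSemiringAction H A] [SMulCommClass H S A]
    (hinj : Function.Injective (algebraMap S A))
    (hrange : Set.range (algebraMap S A) = {a : A | ∀ h : H, h • a = a})
    (hinjp : ∀ s : S, algebraMap S A s ∈ Ideal.span {(p : A)} → s ∈ Ideal.span {(p : S)})
    (hrangep : ∀ a : A, (∀ h : H, h • a - a ∈ Ideal.span {(p : A)}) ↔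
        ∃ s : S, a - algebraMap S A s ∈ Ideal.span {(p : A)})
    {N : Type*} [AddCommGroup N] [Module S N] (m : ℕ) (F : Fin (m + 1) → Submodule S N)
    (hmono : Monotone F) (hbot : F 0 = ⊥) (htop : F (Fin.last m) = ⊤)
    (hquot : ∀ j : Fin m,
      Module.Free S (F j.succ ⧸ ((F j.castSucc).comap (F j.succ).subtype))
      ∨ ∃ κ : Type, Nonempty
          ((F j.succ ⧸ ((F j.castSucc).comap (F j.succ).subtype)) ≃ₗ[S]
            (κ →₀ S ⧸ Ideal.span {(p : S)}))) :
    Function.Injective (fun x : N => (x ⊗ₜ[S] (1 : A) : N ⊗[S] A))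
      ∧ Set.range (fun x : N => (x ⊗ₜ[S] (1 : A) : N ⊗[S] A)) =
        {y : N ⊗[S] A | ∀ h : H,
          LinearMap.lTensor N (DistribMulAction.toLinearMap S A h) y = y} := by
  let f : H → A →ₗ[S] A := fun h => DistribSMul.toLinearMap S A h
  have hf (h : H) : f h 1 = 1 := smul_one h
  have hS : TensorInvariantsEq f S := .self hinj fun a ha => by
    have : a ∈ {a : A | ∀ h : H, h • a = a} := ha
    rwa [← hrange] at this
  have hSp : TensorInvariantsEq f (S ⧸ Ideal.span {(p : S)}) := by
    refine .quotient_span_singleton _ ?_ ?_ <;> rw [map_natCast]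
    exacts [hinjp, fun a ha => (hrangep a).1 ha]
  have hN : TensorInvariantsEq f N := by
    refine .of_linearEquiv (LinearEquiv.ofTop _ htop)
      (.of_filtration hf m F hmono hbot (fun j => ?_) (Fin.last m))
    rcases hquot j with hfree | ⟨κ, ⟨e⟩⟩
    · exact (hS.finsupp _).of_linearEquiv (Module.Free.chooseBasis S _).repr.symm
    · exact (hSp.finsupp κ).of_linearEquiv e.symm
  refine ⟨fun x y hxy => sub_eq_zero.1 (hN.1 _ ?_), Set.ext fun y => ⟨?_, hN.2 y⟩⟩
  · rw [TensorProduct.sub_tmul]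
    exact sub_eq_zero.2 hxy
  · rintro ⟨x, rfl⟩ h
    exact congrArg (x ⊗ₜ[S] ·) (hf h)
end

section
/- Let r ≥ 0 be an integer such that π^r N₁ ⊆ N₂, and assume that for every integer s with 1 ≤ s ≤ r there exists g ∈ Γ with χ(g)^s − 1 invertible in B. Then N₁ ⊆ N₂. -/
open scoped Pointwise in
theorem Submodule.mem_span_singleton_smul_iff {B D : Type*} [CommRing B] [AddCommGroup D]
    [Module B D] (a : B) (N : Submodule B D) (x : D) :
    x ∈ Ideal.span {a} • N ↔ ∃ y ∈ N, a • y = x := by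
  rw [Submodule.ideal_span_singleton_smul, Submodule.mem_smul_pointwise_iff_exists]

/-- If `g • π ≡ u * π` modulo `π ^ 2`, then `g • π ^ s ≡ u ^ s * π ^ s` modulo `π ^ (s + 1)`. -/
theorem exists_smul_pow_eq {B Γ : Type*} [CommRing B] [Group Γ] [MulSemiringAction Γ B]
    {π u : B} {g : Γ} (h : g • π - u * π ∈ Ideal.span {π ^ 2}) (s : ℕ) :
    ∃ c : B, g • π ^ s = (u ^ s + π * c) * π ^ s := by
  obtain ⟨b, hb⟩ := Ideal.mem_span_singleton'.mp h
  have hg : g • π = (u + π * b) * π := by linear_combination -hb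
  obtain ⟨c, hc⟩ := sub_dvd_pow_sub_pow (u + π * b) u s
  refine ⟨b * c, ?_⟩
  rw [smul_pow', hg, mul_pow]
  linear_combination π ^ s * hc

/-- One factor of `π` can be removed from `π ^ (s + 1) N₁ ⊆ N₂` as soon as some `g` acts on `π`
modulo `π ^ 2` through a scalar `u` with `u ^ (s + 1) - 1` invertible. -/
theorem pow_smul_mem_of_pow_succ_smul_mem {B Γ D : Type*} [CommRing B] [Group Γ]
    [MulSemiringAction Γ B] [AddCommGroup D] [Module B D] [DistribMulAction Γ D]
    {π u : B} {g : Γ} (hg : g • π - u * π ∈ Ideal.span {π ^ 2})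
    (hsemi : ∀ (b : B) (x : D), g • (b • x) = (g • b) • (g • x))
    (hπinj : Function.Injective fun x : D => π • x) {N₁ N₂ : Submodule B D}
    (htriv₁ : ∀ x ∈ N₁, g • x - x ∈ Ideal.span {π} • N₁)
    (htriv₂ : ∀ x ∈ N₂, g • x - x ∈ Ideal.span {π} • N₂)
    {s : ℕ} (hs : ∀ x ∈ N₁, π ^ (s + 1) • x ∈ N₂) (hu : IsUnit (u ^ (s + 1) - 1))
    {x : D} (hx : x ∈ N₁) : π ^ s • x ∈ N₂ := by
  obtain ⟨c, hc⟩ := exists_smul_pow_eq hg (s + 1)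
  obtain ⟨n, hn, hnx⟩ := (Submodule.mem_span_singleton_smul_iff _ _ _).mp (htriv₁ x hx)
  obtain ⟨m, hm, hmx⟩ := (Submodule.mem_span_singleton_smul_iff _ _ _).mp (htriv₂ _ (hs x hx))
  have hgx : g • x = x + π • n := by rw [hnx]; abel
  rw [hsemi, hc, hgx] at hmx
  have key : π • ((u ^ (s + 1) - 1) • π ^ s • x) =
      π • (m - c • π ^ (s + 1) • x - (u ^ (s + 1) + π * c) • π ^ (s + 1) • n) := by
    rw [smul_sub, smul_sub, hmx]
    module
  obtain ⟨v, hv⟩ := hu.exists_left_inv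
  have hmem : (u ^ (s + 1) - 1) • π ^ s • x ∈ N₂ := by
    rw [hπinj key]
    exact N₂.sub_mem (N₂.sub_mem hm (N₂.smul_mem _ (hs x hx))) (N₂.smul_mem _ (hs n hn))
  simpa only [smul_smul, ← mul_assoc, hv, one_mul] using N₂.smul_mem v hmem


/-- Let `B` be a commutative ring, `π ∈ B`, `Γ` a group acting on `B` by ring
automorphisms, and `χ : Γ → B^×` with `g(π) − χ(g)·π ∈ π²B` for all `g`.  Let `D` be a
`B`-module with a `Γ`-semilinear action on which multiplication by `π` is injective, and let
`N₁, N₂` be `Γ`-stable `B`-submodules of `D` such that `Γ` acts trivially on `N₁/πN₁` and on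
`N₂/πN₂` and `⋂_{m≥0} π^m N₁ = 0`.  If `r ≥ 0` satisfies `π^r N₁ ⊆ N₂` and for every
`1 ≤ s ≤ r` there exists `g ∈ Γ` with `χ(g)^s − 1` invertible in `B`, then `N₁ ⊆ N₂`. -/
theorem submodule_le_of_pow_smul_le {B : Type*} [CommRing B] (π : B)
    {Γ : Type*} [Group Γ] [MulSemiringAction Γ B]
    (χ : Γ → Bˣ) (hχ : ∀ g : Γ, g • π - (χ g : B) * π ∈ Ideal.span {π ^ 2})
    {D : Type*} [AddCommGroup D] [Module B D] [DistribMulAction Γ D]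
    (hsemi : ∀ (g : Γ) (b : B) (x : D), g • (b • x) = (g • b) • (g • x))
    (hπinj : Function.Injective fun x : D => π • x)
    (N₁ N₂ : Submodule B D)
    (hN₁ : ∀ (g : Γ) (x : D), x ∈ N₁ → g • x ∈ N₁)
    (hN₂ : ∀ (g : Γ) (x : D), x ∈ N₂ → g • x ∈ N₂)
    (htriv₁ : ∀ (g : Γ) (x : D), x ∈ N₁ → g • x - x ∈ Ideal.span {π} • N₁)
    (htriv₂ : ∀ (g : Γ) (x : D), x ∈ N₂ → g • x - x ∈ Ideal.span {π} • N₂)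
    (hsep : (⨅ m : ℕ, Ideal.span {π ^ m} • N₁) = ⊥)
    (r : ℕ) (hr : Ideal.span {π ^ r} • N₁ ≤ N₂)
    (hχunit : ∀ s : ℕ, 1 ≤ s → s ≤ r → ∃ g : Γ, IsUnit ((χ g : B) ^ s - 1)) :
    N₁ ≤ N₂ := by
  have hr' : ∀ x ∈ N₁, π ^ r • x ∈ N₂ := fun x hx =>
    hr ((Submodule.mem_span_singleton_smul_iff _ _ _).mpr ⟨x, hx, rfl⟩)
  clear hr
  induction r with
  | zero => exact fun x hx => by simpa using hr' x hx
  | succ s ih =>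
    obtain ⟨g, hu⟩ := hχunit (s + 1) (Nat.le_add_left 1 s) le_rfl
    exact ih (fun t h₁ h₂ => hχunit t h₁ (Nat.le_succ_of_le h₂)) fun x hx =>
      pow_smul_mem_of_pow_succ_smul_mem (hχ g) (hsemi g) hπinj (htriv₁ g) (htriv₂ g) hr' hu hx
end
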